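/- arXiv:math/0608619 — 2 statements merged into one kernel-verified Lean document; each statement's English description precedes it below -/
import Mathlib

section
/- Let m, g, C > 0 and let X be a real random variable with E[e^{sX}] = (gm/((m−s)(s+g)))^C for all s ∈ (−g, m) and E[e^{sX}] = ∞ for s > m and for s < −g (Variance Gamma). Then log P(X > x) ~ −m x and log P(X ≤ −x) ~ −g x as x → ∞. -/
open Filter MeasureTheory Real Set

/-- Gamma moments of a polynomial. -/
lemma vg_gamma_term (C : ℝ) (hC : 0 < C) (k : ℕ) :
    IntegrableOn (fun t : ℝ => t ^ (C - 1) * exp (-t) * (exp (-t)) ^ k) (Ioi 0) ∧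
    ∫ t in Ioi (0:ℝ), t ^ (C - 1) * exp (-t) * (exp (-t)) ^ k
      = Real.Gamma C * ((k : ℝ) + 1) ^ (-C) := by
  have hk : (0:ℝ) < (k:ℝ) + 1 := by positivity
  have e : ∀ t : ℝ, t ^ (C - 1) * exp (-t) * (exp (-t)) ^ k
      = t ^ (C - 1) * exp (-(((k:ℝ) + 1) * t)) := by
    intro t
    rw [← Real.exp_nat_mul, mul_assoc, ← Real.exp_add]
    congr 2
    ring
  simp_rw [e]
  have h := Real.integral_rpow_mul_exp_neg_mul_Ioi hC hk
  have h2 : ∫ t in Ioi (0:ℝ), t ^ (C - 1) * exp (-(((k:ℝ) + 1) * t))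
      = Real.Gamma C * ((k : ℝ) + 1) ^ (-C) := by
    rw [h, one_div, Real.inv_rpow hk.le, Real.rpow_neg hk.le, mul_comm]
  refine ⟨?_, h2⟩
  by_contra hn
  have h3 := integral_undef hn
  rw [h2] at h3
  have : 0 < Real.Gamma C * ((k : ℝ) + 1) ^ (-C) :=
    mul_pos (Real.Gamma_pos_of_pos hC) (Real.rpow_pos_of_pos hk _)
  linarith

lemma vg_gamma_poly (C : ℝ) (hC : 0 < C) (p : Polynomial ℝ) :
    IntegrableOn (fun t : ℝ => t ^ (C - 1) * exp (-t) * p.eval (exp (-t))) (Ioi 0) ∧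
    ∫ t in Ioi (0:ℝ), t ^ (C - 1) * exp (-t) * p.eval (exp (-t))
      = Real.Gamma C * ∑ k ∈ Finset.range (p.natDegree + 1), p.coeff k * ((k : ℝ) + 1) ^ (-C) := by
  have e : ∀ t : ℝ, t ^ (C - 1) * exp (-t) * p.eval (exp (-t))
      = ∑ k ∈ Finset.range (p.natDegree + 1),
        p.coeff k * (t ^ (C - 1) * exp (-t) * (exp (-t)) ^ k) := by
    intro t
    rw [Polynomial.eval_eq_sum_range, Finset.mul_sum]
    refine Finset.sum_congr rfl fun k _ => by ring
  simp_rw [e]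
  constructor
  · exact integrable_finsetSum _ fun k _ => (vg_gamma_term C hC k).1.const_mul _
  · rw [integral_finsetSum _ fun k _ => (vg_gamma_term C hC k).1.const_mul _, Finset.mul_sum]
    refine Finset.sum_congr rfl fun k _ => ?_
    rw [integral_const_mul, (vg_gamma_term C hC k).2]
    ring

/-- A test polynomial below the indicator of `(e^{-a}, e^{-1})`, with positive gamma mean. -/
lemma vg_exists_poly (C : ℝ) (hC : 0 < C) (a : ℝ) (ha : 1 < a) :
    ∃ p : Polynomial ℝ, (∀ u ∈ Icc (0:ℝ) 1, p.eval u ≤ 1) ∧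
      (∀ u ∈ Icc (0:ℝ) 1, (u ≤ exp (-a) ∨ exp (-1) ≤ u) → p.eval u ≤ 0) ∧
      0 < ∑ k ∈ Finset.range (p.natDegree + 1), p.coeff k * ((k : ℝ) + 1) ^ (-C) := by
  set f : ℝ → ℝ := fun u => max 0 ((u - exp (-a)) * (exp (-1) - u)) with hf
  have hfc : Continuous f := by fun_prop
  have hG := Real.Gamma_pos_of_pos hC
  have e1 : exp (-1) ≤ 1 := by rw [Real.exp_le_one_iff]; norm_num
  have ea : exp (-a) < exp (-1) := by rw [Real.exp_lt_exp]; linarith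
  have ea0 := exp_pos (-a)
  have hf0 : ∀ u, 0 ≤ f u := fun u => le_max_left _ _
  have hf1 : ∀ u ∈ Icc (0:ℝ) 1, f u ≤ 1 := by
    intro u hu
    refine max_le zero_le_one ?_
    nlinarith [hu.1, hu.2]
  have hfz : ∀ u : ℝ, (u ≤ exp (-a) ∨ exp (-1) ≤ u) → f u = 0 := by
    intro u hu
    refine max_eq_left ?_
    rcases hu with h | h
    · exact mul_nonpos_of_nonpos_of_nonneg (by linarith) (by linarith)
    · exact mul_nonpos_of_nonneg_of_nonpos (by linarith) (by linarith)
  have hw : IntegrableOn (fun t : ℝ => t ^ (C - 1) * exp (-t)) (Ioi 0) := by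
    simpa using (vg_gamma_term C hC 0).1
  have hwi : ∫ t in Ioi (0:ℝ), t ^ (C - 1) * exp (-t) = Real.Gamma C := by
    simpa using (vg_gamma_term C hC 0).2
  have hfi : IntegrableOn (fun t : ℝ => t ^ (C - 1) * exp (-t) * f (exp (-t))) (Ioi 0) := by
    refine Integrable.mul_bdd (c := 1) hw ?_ ?_
    · exact (hfc.comp (by fun_prop : Continuous fun t : ℝ => exp (-t))).aestronglyMeasurable
    · filter_upwards [ae_restrict_mem measurableSet_Ioi] with t ht
      rw [Real.norm_of_nonneg (hf0 _)]
      refine hf1 _ ⟨(exp_pos _).le, ?_⟩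
      rw [Real.exp_le_one_iff]; simpa using le_of_lt ht
  set L := ∫ t in Ioi (0:ℝ), t ^ (C - 1) * exp (-t) * f (exp (-t)) with hL
  have hLpos : 0 < L := by
    rw [hL, setIntegral_pos_iff_support_of_nonneg_ae _ hfi]
    · refine lt_of_lt_of_le (b := volume (Ioo (1:ℝ) a)) ?_ (measure_mono ?_)
      · simp [ha]
      · intro t ht
        have h0 : 0 < t := by linarith [ht.1]
        refine ⟨?_, h0⟩
        have : 0 < f (exp (-t)) := by
          refine lt_max_of_lt_right (mul_pos ?_ ?_)
          · rw [sub_pos, Real.exp_lt_exp]; linarith [ht.2]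
          · rw [sub_pos, Real.exp_lt_exp]; linarith [ht.1]
        exact (mul_pos (mul_pos (Real.rpow_pos_of_pos h0 _) (exp_pos _)) this).ne'
    · filter_upwards [ae_restrict_mem measurableSet_Ioi] with t ht
      exact mul_nonneg (mul_nonneg (Real.rpow_nonneg (le_of_lt ht) _) (exp_pos _).le) (hf0 _)
  set ε := L / (4 * Real.Gamma C) with hε
  have hεpos : 0 < ε := by positivity
  obtain ⟨p, hp⟩ := exists_polynomial_near_of_continuousOn 0 1 (fun u => f u - ε)
    (by fun_prop) ε hεpos
  have hp1 : ∀ u ∈ Icc (0:ℝ) 1, p.eval u ≤ f u := by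
    intro u hu; have := abs_lt.1 (hp u hu); linarith [this.2]
  have hp2 : ∀ u ∈ Icc (0:ℝ) 1, f u - 2 * ε ≤ p.eval u := by
    intro u hu; have := abs_lt.1 (hp u hu); linarith [this.1]
  refine ⟨p, fun u hu => (hp1 u hu).trans (hf1 u hu), fun u hu h => ?_, ?_⟩
  · rw [← hfz u h]; exact hp1 u hu
  · have hP := vg_gamma_poly C hC p
    have hge : L - 2 * ε * Real.Gamma C
        ≤ ∫ t in Ioi (0:ℝ), t ^ (C - 1) * exp (-t) * p.eval (exp (-t)) := by
      rw [hL, ← hwi, ← integral_const_mul, ← integral_sub hfi (hw.const_mul _)]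
      refine setIntegral_mono_on (hfi.sub (hw.const_mul _)) hP.1 measurableSet_Ioi ?_
      intro t ht
      have h0 : 0 ≤ t ^ (C - 1) * exp (-t) :=
        mul_nonneg (Real.rpow_nonneg (le_of_lt ht) _) (exp_pos _).le
      have := mul_le_mul_of_nonneg_left (hp2 (exp (-t)) ⟨(exp_pos _).le, by
        rw [Real.exp_le_one_iff]; simpa using le_of_lt ht⟩) h0
      linarith
    rw [hP.2] at hge
    have h4 : 2 * ε * Real.Gamma C = L / 2 := by rw [hε]; field_simp; norm_num
    rw [h4] at hge
    exact pos_of_mul_pos_right (by linarith) hG.le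

/-- Asymptotics of the truncated mgf near the critical exponent. -/
lemma vg_trunc {Ω : Type*} [MeasurableSpace Ω] (μ : Measure Ω) [IsProbabilityMeasure μ]
    (X : Ω → ℝ) (hX : Measurable X)
    (m g C : ℝ) (hm : 0 < m) (hg : 0 < g) (hC : 0 < C)
    (hmgf : ∀ s ∈ Set.Ioo (-g) m,
      Integrable (fun ω => Real.exp (s * X ω)) μ ∧
      ∫ ω, Real.exp (s * X ω) ∂μ = (g * m / ((m - s) * (s + g))) ^ C) (q : ℝ) (hq : 0 < q) :
    Tendsto (fun x : ℝ => x ^ (-C) * ∫ ω in {ω | 0 < X ω}, exp ((m - q / x) * X ω) ∂μ) atTop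
      (nhds ((g * m / (m + g)) ^ C * q ^ (-C))) := by
  have hS : MeasurableSet {ω | 0 < X ω} := measurableSet_lt measurable_const hX
  have hqx : Tendsto (fun x : ℝ => q / x) atTop (nhds 0) := tendsto_const_nhds.div_atTop tendsto_id
  have hxC : Tendsto (fun x : ℝ => x ^ (-C)) atTop (nhds 0) := tendsto_rpow_neg_atTop hC
  have hbd : Tendsto (fun x : ℝ => x ^ (-C) * ∫ ω in {ω | 0 < X ω}ᶜ, exp ((m - q / x) * X ω) ∂μ)
      atTop (nhds 0) := by
    refine squeeze_zero' ?_ ?_ hxC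
    · filter_upwards [eventually_gt_atTop 0] with x hx
      exact mul_nonneg (Real.rpow_nonneg hx.le _) (integral_nonneg fun _ => (exp_pos _).le)
    · filter_upwards [eventually_gt_atTop 0, hqx.eventually (gt_mem_nhds hm)] with x hx hx2
      refine mul_le_of_le_one_right (Real.rpow_nonneg hx.le _) ?_
      have hi := (hmgf (m - q / x) ⟨by linarith, by linarith [div_pos hq hx]⟩).1
      calc ∫ ω in {ω | 0 < X ω}ᶜ, exp ((m - q / x) * X ω) ∂μ
          ≤ ∫ ω in {ω | 0 < X ω}ᶜ, (1:ℝ) ∂μ := by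
            refine setIntegral_mono_on hi.integrableOn (by simp) hS.compl fun ω hω => ?_
            rw [Real.exp_le_one_iff]
            exact mul_nonpos_of_nonneg_of_nonpos (by linarith) (not_lt.1 hω)
        _ ≤ 1 := by
            simp [measureReal_le_one]
  have hmain : Tendsto (fun x : ℝ => x ^ (-C) * ∫ ω, exp ((m - q / x) * X ω) ∂μ) atTop
      (nhds ((g * m / (m + g)) ^ C * q ^ (-C))) := by
    have h1 : Tendsto (fun x : ℝ => (g * m / (m + g - q / x)) ^ C * q ^ (-C)) atTop
      (nhds ((g * m / (m + g - 0)) ^ C * q ^ (-C))) := by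
      refine Tendsto.mul_const _ (Tendsto.rpow_const ?_ (Or.inr hC.le))
      exact tendsto_const_nhds.div (tendsto_const_nhds.sub hqx) (by linarith)
    rw [sub_zero] at h1
    refine h1.congr' ?_
    filter_upwards [eventually_gt_atTop 0, hqx.eventually (gt_mem_nhds hm)] with x hx hx2
    have hd : 0 < m + g - q / x := by linarith
    rw [(hmgf (m - q / x) ⟨by linarith, by linarith [div_pos hq hx]⟩).2]
    have : g * m / ((m - (m - q / x)) * (m - q / x + g)) = (g * m / (m + g - q / x)) * (q⁻¹ * x) := by
      have : m - q / x + g = m + g - q / x := by ring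
      rw [this, sub_sub_cancel]
      have := hd.ne'
      generalize m + g - q / x = D at *
      field_simp
    rw [this, Real.mul_rpow (by positivity) (by positivity), Real.mul_rpow (by positivity) hx.le,
      Real.inv_rpow hq.le, ← Real.rpow_neg hq.le, Real.rpow_neg hx.le]
    have := (Real.rpow_pos_of_pos hx C).ne'
    field_simp
  have := hmain.sub hbd
  rw [sub_zero] at this
  refine this.congr' ?_
  filter_upwards [eventually_gt_atTop 0, hqx.eventually (gt_mem_nhds hm)] with x hx hx2
  have hi := (hmgf (m - q / x) ⟨by linarith, by linarith [div_pos hq hx]⟩).1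
  rw [← integral_add_compl hS hi]
  ring

lemma vg_lower {Ω : Type*} [MeasurableSpace Ω] (μ : Measure Ω) [IsProbabilityMeasure μ]
    (X : Ω → ℝ) (hX : Measurable X)
    (m g C : ℝ) (hm : 0 < m) (hg : 0 < g) (hC : 0 < C)
    (hmgf : ∀ s ∈ Set.Ioo (-g) m,
      Integrable (fun ω => Real.exp (s * X ω)) μ ∧
      ∫ ω, Real.exp (s * X ω) ∂μ = (g * m / ((m - s) * (s + g))) ^ C) (a : ℝ) (ha : 1 < a) :
    ∃ κ : ℝ, 0 < κ ∧ ∀ᶠ x : ℝ in atTop, κ * exp (-(m * a * x)) ≤ (μ {ω | x < X ω}).toReal := by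
  obtain ⟨p, hp1, hp2, hp3⟩ := vg_exists_poly C hC a ha
  set c := (g * m / (m + g)) ^ C with hc
  have hcpos : 0 < c := Real.rpow_pos_of_pos (by positivity) _
  set Λ := ∑ k ∈ Finset.range (p.natDegree + 1), p.coeff k * ((k : ℝ) + 1) ^ (-C) with hΛ
  have hlim : Tendsto (fun x : ℝ => ∑ k ∈ Finset.range (p.natDegree + 1), p.coeff k *
      (x ^ (-C) * ∫ ω in {ω | 0 < X ω}, exp ((m - ((k:ℝ) + 1) / x) * X ω) ∂μ)) atTop
      (nhds (∑ k ∈ Finset.range (p.natDegree + 1), p.coeff k * (c * ((k : ℝ) + 1) ^ (-C)))) :=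
    tendsto_finsetSum _ fun k _ =>
      (vg_trunc μ X hX m g C hm hg hC hmgf ((k:ℝ) + 1) (by positivity)).const_mul _
  have hv : (∑ k ∈ Finset.range (p.natDegree + 1), p.coeff k * (c * ((k : ℝ) + 1) ^ (-C)))
      = c * Λ := by
    rw [hΛ, Finset.mul_sum]
    exact Finset.sum_congr rfl fun k _ => by ring
  rw [hv] at hlim
  have hcL : 0 < c * Λ := mul_pos hcpos hp3
  refine ⟨c * Λ / 2, by positivity, ?_⟩
  have hsmall : ∀ᶠ x : ℝ in atTop, ((p.natDegree : ℝ) + 1) / x < m :=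
    (tendsto_const_nhds.div_atTop tendsto_id : Tendsto (fun x : ℝ => ((p.natDegree : ℝ) + 1) / x)
      atTop (nhds 0)).eventually (gt_mem_nhds hm)
  filter_upwards [hlim.eventually (lt_mem_nhds (half_lt_self hcL)), eventually_ge_atTop 1, hsmall]
    with x hx hx1 hx2
  have hx0 : 0 < x := by linarith
  have hS : MeasurableSet {ω | 0 < X ω} := measurableSet_lt measurable_const hX
  have hT : MeasurableSet {ω | x < X ω} := measurableSet_lt measurable_const hX
  have hki : ∀ k ∈ Finset.range (p.natDegree + 1),
      IntegrableOn (fun ω => p.coeff k * exp ((m - ((k:ℝ) + 1) / x) * X ω)) {ω | 0 < X ω} μ := by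
    intro k hk
    have hk' : (k:ℝ) ≤ p.natDegree := by
      exact_mod_cast Nat.lt_succ_iff.1 (Finset.mem_range.1 hk)
    have h1 : ((k:ℝ) + 1) / x ≤ ((p.natDegree : ℝ) + 1) / x := by gcongr
    have h2 : 0 < ((k:ℝ) + 1) / x := by positivity
    exact ((hmgf _ ⟨by linarith, by linarith⟩).1.const_mul _).integrableOn
  have hsum : ∑ k ∈ Finset.range (p.natDegree + 1), p.coeff k *
      (x ^ (-C) * ∫ ω in {ω | 0 < X ω}, exp ((m - ((k:ℝ) + 1) / x) * X ω) ∂μ)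
      = x ^ (-C) * ∫ ω in {ω | 0 < X ω}, (∑ k ∈ Finset.range (p.natDegree + 1),
        p.coeff k * exp ((m - ((k:ℝ) + 1) / x) * X ω)) ∂μ := by
    rw [integral_finsetSum _ hki, Finset.mul_sum]
    refine Finset.sum_congr rfl fun k _ => ?_
    rw [integral_const_mul]; ring
  rw [hsum] at hx
  have hpt : ∀ ω, (∑ k ∈ Finset.range (p.natDegree + 1),
        p.coeff k * exp ((m - ((k:ℝ) + 1) / x) * X ω))
      = exp ((m - 1 / x) * X ω) * p.eval (exp (-(X ω / x))) := by
    intro ω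
    rw [Polynomial.eval_eq_sum_range, Finset.mul_sum]
    refine Finset.sum_congr rfl fun k _ => ?_
    rw [← Real.exp_nat_mul, mul_left_comm, ← Real.exp_add]
    congr 2
    field_simp
    ring
  have hub : ∫ ω in {ω | 0 < X ω}, (∑ k ∈ Finset.range (p.natDegree + 1),
        p.coeff k * exp ((m - ((k:ℝ) + 1) / x) * X ω)) ∂μ
      ≤ exp (m * a * x) * (μ {ω | x < X ω}).toReal := by
    have hmono : ∫ ω in {ω | 0 < X ω}, (∑ k ∈ Finset.range (p.natDegree + 1),
        p.coeff k * exp ((m - ((k:ℝ) + 1) / x) * X ω)) ∂μ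
        ≤ ∫ ω in {ω | 0 < X ω}, {ω | x < X ω}.indicator (fun _ => exp (m * a * x)) ω ∂μ := by
      refine setIntegral_mono_on (integrable_finsetSum _ hki)
        ((integrable_const _).indicator hT) hS fun ω hω => ?_
      have hω0 : 0 < X ω := hω
      rw [hpt]
      have hu : exp (-(X ω / x)) ∈ Icc (0:ℝ) 1 := by
        refine ⟨(exp_pos _).le, ?_⟩
        rw [Real.exp_le_one_iff]
        have : 0 < X ω / x := by positivity
        linarith
      by_cases h1 : x < X ω
      · rw [indicator_of_mem (show ω ∈ {ω | x < X ω} from h1)]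
        by_cases h2 : X ω < a * x
        · calc exp ((m - 1 / x) * X ω) * p.eval (exp (-(X ω / x)))
              ≤ exp ((m - 1 / x) * X ω) * 1 :=
                mul_le_mul_of_nonneg_left (hp1 _ hu) (exp_pos _).le
            _ ≤ exp (m * a * x) := by
                rw [mul_one, Real.exp_le_exp]
                have : 0 < 1 / x * X ω := by positivity
                nlinarith
        · refine le_trans (mul_nonpos_of_nonneg_of_nonpos (exp_pos _).le
            (hp2 _ hu (Or.inl ?_))) (exp_pos _).le
          rw [Real.exp_le_exp, neg_le_neg_iff, le_div_iff₀ hx0]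
          exact not_lt.1 h2
      · rw [indicator_of_notMem (show ω ∉ {ω | x < X ω} from h1)]
        refine mul_nonpos_of_nonneg_of_nonpos (exp_pos _).le (hp2 _ hu (Or.inr ?_))
        rw [Real.exp_le_exp, neg_le_neg_iff, div_le_one hx0]
        exact not_lt.1 h1
    refine hmono.trans ?_
    calc ∫ ω in {ω | 0 < X ω}, {ω | x < X ω}.indicator (fun _ => exp (m * a * x)) ω ∂μ
        ≤ ∫ ω, {ω | x < X ω}.indicator (fun _ => exp (m * a * x)) ω ∂μ :=
          setIntegral_le_integral ((integrable_const _).indicator hT)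
            (Eventually.of_forall fun ω => indicator_nonneg (fun _ _ => (exp_pos _).le) ω)
      _ = exp (m * a * x) * (μ {ω | x < X ω}).toReal := by
          rw [integral_indicator_const _ hT, smul_eq_mul, mul_comm, measureReal_def]
  have hxC : x ^ (-C) ≤ 1 := Real.rpow_le_one_of_one_le_of_nonpos hx1 (by linarith)
  have hxC0 : 0 ≤ x ^ (-C) := Real.rpow_nonneg hx0.le _
  have hR : 0 ≤ exp (m * a * x) * (μ {ω | x < X ω}).toReal := by positivity
  have hfin : c * Λ / 2 ≤ exp (m * a * x) * (μ {ω | x < X ω}).toReal := by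
    calc c * Λ / 2 ≤ _ := hx.le
      _ ≤ x ^ (-C) * (exp (m * a * x) * (μ {ω | x < X ω}).toReal) :=
        mul_le_mul_of_nonneg_left hub hxC0
      _ ≤ _ := mul_le_of_le_one_left hR hxC
  rw [Real.exp_neg, ← div_eq_mul_inv, div_le_iff₀ (exp_pos _), mul_comm]
  linarith

lemma vg_one_sided {Ω : Type*} [MeasurableSpace Ω] (μ : Measure Ω) [IsProbabilityMeasure μ]
    (X : Ω → ℝ) (hX : Measurable X)
    (m g C : ℝ) (hm : 0 < m) (hg : 0 < g) (hC : 0 < C)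
    (hmgf : ∀ s ∈ Set.Ioo (-g) m,
      Integrable (fun ω => Real.exp (s * X ω)) μ ∧
      ∫ ω, Real.exp (s * X ω) ∂μ = (g * m / ((m - s) * (s + g))) ^ C)
    (T : ℝ → ℝ) (hT1 : ∀ x, (μ {ω | x < X ω}).toReal ≤ T x)
    (hT2 : ∀ x, T x ≤ (μ {ω | x ≤ X ω}).toReal) :
    Tendsto (fun x => Real.log (T x) / (-(m * x))) atTop (nhds 1) := by
  have hpos : ∀ᶠ x in atTop, 0 < T x := by
    obtain ⟨κ, hκ, h⟩ := vg_lower μ X hX m g C hm hg hC hmgf 2 (by norm_num)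
    filter_upwards [h] with x hx
    exact lt_of_lt_of_le (by positivity) (hx.trans (hT1 x))
  rw [tendsto_order]
  constructor
  · intro b hb

    obtain ⟨r, hr1, hr2⟩ := exists_between (max_lt hb one_pos)
    have hrb : b < r := lt_of_le_of_lt (le_max_left _ _) hr1
    have hr0 : 0 < r := lt_of_le_of_lt (le_max_right _ _) hr1
    have hs : r * m ∈ Ioo (-g) m := ⟨by nlinarith, by nlinarith⟩
    have hlim : Tendsto (fun x : ℝ => r - Real.log (ProbabilityTheory.mgf X μ (r * m)) / (m * x))
        atTop (nhds (r - 0)) :=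
      tendsto_const_nhds.sub (tendsto_const_nhds.div_atTop (tendsto_id.const_mul_atTop hm))
    rw [sub_zero] at hlim
    filter_upwards [hlim.eventually (lt_mem_nhds hrb), hpos, eventually_gt_atTop 0]
      with x hx hTx hx0
    refine hx.trans_le ?_
    have hch := ProbabilityTheory.measure_ge_le_exp_mul_mgf (μ := μ) (X := X) (t := r * m) x
      (by positivity) (hmgf _ hs).1
    have hM : 0 < ProbabilityTheory.mgf X μ (r * m) := ProbabilityTheory.mgf_pos (hmgf _ hs).1
    have hlog : Real.log (T x) ≤ -(r * m) * x + Real.log (ProbabilityTheory.mgf X μ (r * m)) := by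
      have := Real.log_le_log hTx ((hT2 x).trans hch)
      rwa [Real.log_mul (exp_pos _).ne' hM.ne', Real.log_exp] at this
    have hmx : 0 < m * x := by positivity
    rw [div_neg, ← neg_div, le_div_iff₀ hmx, sub_mul, div_mul_cancel₀ _ hmx.ne']
    linarith
  · intro b hb
    obtain ⟨a, ha1, ha2⟩ := exists_between hb
    obtain ⟨κ, hκ, h⟩ := vg_lower μ X hX m g C hm hg hC hmgf a ha1
    have hlim : Tendsto (fun x : ℝ => a - Real.log κ / (m * x))
        atTop (nhds (a - 0)) :=
      tendsto_const_nhds.sub (tendsto_const_nhds.div_atTop (tendsto_id.const_mul_atTop hm))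
    rw [sub_zero] at hlim
    filter_upwards [hlim.eventually (gt_mem_nhds ha2), h, eventually_gt_atTop 0]
      with x hx hTx hx0
    refine lt_of_le_of_lt ?_ hx
    have hlog : Real.log κ - m * a * x ≤ Real.log (T x) := by
      have := Real.log_le_log (by positivity) (hTx.trans (hT1 x))
      rw [Real.log_mul hκ.ne' (exp_pos _).ne', Real.log_exp] at this
      linarith
    have hmx : 0 < m * x := by positivity
    rw [div_neg, ← neg_div, div_le_iff₀ hmx, sub_mul, div_mul_cancel₀ _ hmx.ne']
    linarith

/-- **Variance Gamma.** If `X` has mgf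
`E[e^{sX}] = (gm/((m-s)(s+g)))^C` on `(-g, m)`, infinite for `s > m` and `s < -g`,
then `log P(X > x) ~ -m x` and `log P(X ≤ -x) ~ -g x` as `x → ∞`. -/
theorem varianceGamma_tails
    {Ω : Type*} [MeasurableSpace Ω] (μ : Measure Ω) [IsProbabilityMeasure μ]
    (X : Ω → ℝ) (hX : Measurable X)
    (m g C : ℝ) (hm : 0 < m) (hg : 0 < g) (hC : 0 < C)
    (hmgf : ∀ s ∈ Set.Ioo (-g) m,
      Integrable (fun ω => Real.exp (s * X ω)) μ ∧
      ∫ ω, Real.exp (s * X ω) ∂μ = (g * m / ((m - s) * (s + g))) ^ C)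
    (hinf : ∀ s : ℝ, m < s ∨ s < -g → ¬ Integrable (fun ω => Real.exp (s * X ω)) μ) :
    Tendsto (fun x => Real.log ((μ {ω | x < X ω}).toReal) / (-(m * x)))
      atTop (nhds 1) ∧
    Tendsto (fun x => Real.log ((μ {ω | X ω ≤ -x}).toReal) / (-(g * x)))
      atTop (nhds 1) := by
  constructor
  · refine vg_one_sided μ X hX m g C hm hg hC hmgf _ (fun x => le_rfl) fun x => ?_
    exact ENNReal.toReal_mono (measure_ne_top _ _) (measure_mono fun ω (h : x < X ω) => h.le)
  · refine vg_one_sided μ (fun ω => -X ω) hX.neg g m C hg hm hC ?_ _ (fun x => ?_) fun x => ?_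
    · intro s hs
      have h := hmgf (-s) ⟨by linarith [hs.2], by linarith [hs.1]⟩
      simp only [neg_mul] at h
      simp only [mul_neg]
      refine ⟨h.1, h.2.trans ?_⟩
      congr 1
      rw [mul_comm g m]
      congr 1
      ring
    · refine ENNReal.toReal_mono (measure_ne_top _ _) (measure_mono fun ω (h : x < -X ω) => ?_)
      show X ω ≤ -x
      linarith
    · refine ENNReal.toReal_mono (measure_ne_top _ _) (measure_mono fun ω (h : X ω ≤ -x) => ?_)
      show x ≤ -X ω
      linarith
end

section
/- Let α > 0, |β| < α, δ > 0, μ ∈ ℝ, and let X be a real random variable with E[e^{sX}] = exp{δ(√(α²−β²) − √(α²−(β+s)²)) + μs} for all s ∈ [−(α+β), α−β] and E[e^{sX}] = ∞ otherwise (Normal Inverse Gaussian). Then log P(X > x) ~ −(α−β) x and log P(X ≤ −x) ~ −(α+β) x as x → ∞. -/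
open Filter MeasureTheory Real Set

lemma aux_int_wt {Ω : Type*} [MeasurableSpace Ω] (μ : Measure Ω) (X : Ω → ℝ) (hX : Measurable X)
    (r t : ℝ) (ht : 0 < t) (hr : Integrable (fun ω => Real.exp (r * X ω)) μ) :
    Integrable (fun ω => max (X ω) 0 * Real.exp ((r - t) * X ω)) μ := by
  refine (hr.const_mul (1 / t)).mono' (by fun_prop) ?_
  filter_upwards with ω
  have h0 : (0:ℝ) ≤ max (X ω) 0 := le_max_right _ _
  rw [Real.norm_of_nonneg (by positivity)]
  have e : Real.exp (r * X ω) = Real.exp (t * X ω) * Real.exp ((r - t) * X ω) := by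
    rw [← Real.exp_add]; ring_nf
  rw [e, ← mul_assoc]
  gcongr
  rw [one_div, inv_mul_eq_div, le_div_iff₀ ht]
  rcases le_total (X ω) 0 with h | h
  · rw [max_eq_right h]; simp; positivity
  · rw [max_eq_left h]
    have := Real.add_one_le_exp (t * X ω)
    nlinarith

lemma aux_pos_part {Ω : Type*} [MeasurableSpace Ω] (μ : Measure Ω) [IsProbabilityMeasure μ]
    (X : Ω → ℝ) (hX : Measurable X)
    (r κ : ℝ) (hr0 : 0 < r) (hr : Integrable (fun ω => Real.exp (r * X ω)) μ)
    (h : Tendsto (fun s => √s * ∫ ω, X ω * Real.exp ((r - s) * X ω) ∂μ) (nhdsWithin 0 (Ioi 0))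
      (nhds κ)) :
    Tendsto (fun s => √s * ∫ ω, max (X ω) 0 * Real.exp ((r - s) * X ω) ∂μ) (nhdsWithin 0 (Ioi 0))
      (nhds κ) := by
  have hb : ∀ s, s < r / 2 → ∀ ω, 0 ≤ max (-X ω) 0 * Real.exp ((r - s) * X ω) ∧
      max (-X ω) 0 * Real.exp ((r - s) * X ω) ≤ 2 / r := by
    intro s hs ω
    have h0 : (0:ℝ) ≤ max (-X ω) 0 := le_max_right _ _
    refine ⟨by positivity, ?_⟩
    rcases le_total (X ω) 0 with h | h
    · rw [max_eq_left (by linarith)]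
      have h1 : Real.exp ((r - s) * X ω) ≤ Real.exp (r / 2 * X ω) := by
        apply Real.exp_le_exp.2; nlinarith
      have h2 := Real.add_one_le_exp (-(r / 2 * X ω))
      have h3 : Real.exp (-(r / 2 * X ω)) * Real.exp (r / 2 * X ω) = 1 := by
        rw [← Real.exp_add]; simp
      rw [le_div_iff₀ hr0]
      have h4 : -X ω * r ≤ 2 * Real.exp (-(r / 2 * X ω)) := by linarith
      calc -X ω * Real.exp ((r - s) * X ω) * r
          = (-X ω * r) * Real.exp ((r - s) * X ω) := by ring
        _ ≤ (2 * Real.exp (-(r / 2 * X ω))) * Real.exp (r / 2 * X ω) := by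
            gcongr
        _ = 2 := by rw [mul_assoc, h3]; ring
    · rw [max_eq_right (by linarith)]; simp; positivity
  have hsm : ∀ᶠ s : ℝ in nhdsWithin 0 (Ioi 0), 0 < s ∧ s < r / 2 := by
    filter_upwards [Ioo_mem_nhdsGT (show (0:ℝ) < r / 2 by positivity)] with s hs using hs
  have hint : ∀ s, s < r / 2 → Integrable (fun ω => max (-X ω) 0 * Real.exp ((r - s) * X ω)) μ := by
    intro s hs
    refine (integrable_const (2 / r)).mono' (by fun_prop) ?_
    filter_upwards with ω
    rw [Real.norm_of_nonneg (hb s hs ω).1]; exact (hb s hs ω).2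
  have hsq : Tendsto (fun s : ℝ => √s) (nhdsWithin 0 (Ioi 0)) (nhds 0) := by
    have := (Real.continuous_sqrt.tendsto 0).mono_left (nhdsWithin_le_nhds (s := Ioi 0))
    simpa using this
  have hN : Tendsto (fun s => √s * ∫ ω, max (-X ω) 0 * Real.exp ((r - s) * X ω) ∂μ)
      (nhdsWithin 0 (Ioi 0)) (nhds 0) := by
    refine squeeze_zero' (g := fun s => √s * (2 / r)) ?_ ?_ (by simpa using hsq.mul_const (2 / r))
    · filter_upwards [hsm] with s hs
      exact mul_nonneg (Real.sqrt_nonneg _) (integral_nonneg fun ω => (hb s hs.2 ω).1)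
    · filter_upwards [hsm] with s hs
      gcongr
      calc _ ≤ ∫ ω, (2 / r) ∂μ :=
            integral_mono (hint s hs.2) (integrable_const _) fun ω => (hb s hs.2 ω).2
        _ = 2 / r := by simp
  have := h.add hN
  rw [add_zero] at this
  refine this.congr' ?_
  filter_upwards [hsm] with s hs
  have e : (fun ω => X ω * Real.exp ((r - s) * X ω)) = fun ω =>
      max (X ω) 0 * Real.exp ((r - s) * X ω) - max (-X ω) 0 * Real.exp ((r - s) * X ω) := by
    funext ω
    rcases le_total (X ω) 0 with h | h
    · rw [max_eq_right h, max_eq_left (by linarith)]; ring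
    · rw [max_eq_left h, max_eq_right (by linarith)]; ring
  rw [e, integral_sub (aux_int_wt μ X hX r s hs.1 hr) (hint s hs.2)]
  ring

lemma aux_int_wtf {Ω : Type*} [MeasurableSpace Ω] (μ : Measure Ω) (X : Ω → ℝ) (hX : Measurable X)
    (r t : ℝ) (ht : 0 < t) (hr : Integrable (fun ω => Real.exp (r * X ω)) μ)
    (f : ℝ → ℝ) (hf : Continuous f) :
    Integrable (fun ω => max (X ω) 0 * Real.exp ((r - t) * X ω) *
      f (Real.exp (-(t * max (X ω) 0)))) μ := by
  obtain ⟨C, hC⟩ := isCompact_Icc.exists_bound_of_continuousOn (s := Icc (0:ℝ) 1) hf.continuousOn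
  refine (aux_int_wt μ X hX r t ht hr).mul_bdd (c := C) ?_ ?_
  · exact (hf.measurable.comp (by fun_prop)).aestronglyMeasurable
  · filter_upwards with ω
    apply hC
    refine ⟨by positivity, ?_⟩
    rw [Real.exp_le_one_iff]
    have h0 : (0:ℝ) ≤ max (X ω) 0 := le_max_right _ _
    nlinarith [mul_nonneg ht.le h0]

lemma aux_int_gam (f : ℝ → ℝ) (hf : Continuous f) :
    Integrable (fun y : ℝ => y ^ ((1/2:ℝ) - 1) * Real.exp (-y) * f (Real.exp (-y)))
      (volume.restrict (Ioi 0)) := by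
  obtain ⟨C, hC⟩ := isCompact_Icc.exists_bound_of_continuousOn (s := Icc (0:ℝ) 1) hf.continuousOn
  have h := Real.GammaIntegral_convergent (s := 1/2) (by norm_num)
  have h' : Integrable (fun y : ℝ => y ^ ((1/2:ℝ) - 1) * Real.exp (-y))
      (volume.restrict (Ioi 0)) := by
    refine h.congr ?_
    filter_upwards with y using mul_comm _ _
  refine h'.mul_bdd (c := C) ?_ ?_
  · exact (hf.comp (by fun_prop)).aestronglyMeasurable
  · filter_upwards [ae_restrict_mem measurableSet_Ioi] with y hy
    apply hC
    refine ⟨by positivity, ?_⟩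
    rw [Real.exp_le_one_iff]
    have : (0:ℝ) < y := hy
    linarith

lemma aux_poly {Ω : Type*} [MeasurableSpace Ω] (μ : Measure Ω)
    (X : Ω → ℝ) (hX : Measurable X)
    (r κ : ℝ) (hr : Integrable (fun ω => Real.exp (r * X ω)) μ)
    (h : Tendsto (fun s => √s * ∫ ω, max (X ω) 0 * Real.exp ((r - s) * X ω) ∂μ)
      (nhdsWithin 0 (Ioi 0)) (nhds κ)) (p : Polynomial ℝ) :
    Tendsto (fun t => √t * ∫ ω, max (X ω) 0 * Real.exp ((r - t) * X ω) *
      p.eval (Real.exp (-(t * max (X ω) 0))) ∂μ) (nhdsWithin 0 (Ioi 0))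
      (nhds (κ / √π * ∫ y in Ioi (0:ℝ), y ^ ((1/2:ℝ) - 1) * Real.exp (-y) *
        p.eval (Real.exp (-y)))) := by
  have hpos : ∀ᶠ s : ℝ in nhdsWithin 0 (Ioi 0), 0 < s := self_mem_nhdsWithin
  induction p using Polynomial.induction_on' with
  | add p q hp hq =>
    simp only [Polynomial.eval_add, mul_add]
    rw [integral_add (aux_int_gam _ p.continuous) (aux_int_gam _ q.continuous), mul_add]
    refine (hp.add hq).congr' ?_
    filter_upwards [hpos] with t ht
    rw [integral_add (aux_int_wtf μ X hX r t ht hr _ p.continuous)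
      (aux_int_wtf μ X hX r t ht hr _ q.continuous), mul_add]
  | monomial n a =>
    simp only [Polynomial.eval_monomial]
    have hn : (0:ℝ) < n + 1 := by positivity
    have e1 : ∫ y in Ioi (0:ℝ), y ^ ((1/2:ℝ) - 1) * Real.exp (-y) * (a * Real.exp (-y) ^ n)
        = a * ((1 / √((n:ℝ) + 1)) * √π) := by
      have := Real.integral_rpow_mul_exp_neg_mul_Ioi (a := 1/2) (r := (n:ℝ) + 1) (by norm_num) hn
      rw [Real.Gamma_one_half_eq, ← Real.sqrt_eq_rpow, Real.sqrt_div zero_le_one,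
        Real.sqrt_one] at this
      rw [← this, ← integral_const_mul]
      congr 1
      funext y
      rw [← Real.exp_nat_mul]
      have : Real.exp (-(((n:ℝ) + 1) * y)) = Real.exp (-y) * Real.exp (n * -y) := by
        rw [← Real.exp_add]; ring_nf
      rw [this]; ring
    rw [e1]
    have hpi : √π ≠ 0 := by positivity
    have e2 : κ / √π * (a * ((1 / √((n:ℝ) + 1)) * √π)) = (a / √((n:ℝ) + 1)) * κ := by
      field_simp
    rw [e2]
    have hc : Tendsto (fun t : ℝ => ((n:ℝ) + 1) * t) (nhdsWithin 0 (Ioi 0))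
        (nhdsWithin 0 (Ioi 0)) := by
      rw [tendsto_nhdsWithin_iff]
      constructor
      · have : Tendsto (fun t : ℝ => ((n:ℝ) + 1) * t) (nhds 0) (nhds (((n:ℝ) + 1) * 0)) :=
          Continuous.tendsto (by fun_prop) 0
        rw [mul_zero] at this
        exact this.mono_left nhdsWithin_le_nhds
      · filter_upwards [hpos] with t ht
        exact mul_pos hn ht
    refine ((h.comp hc).const_mul (a / √((n:ℝ) + 1))).congr' ?_
    filter_upwards [hpos] with t ht
    simp only [Function.comp]
    rw [Real.sqrt_mul hn.le]
    have hs : √((n:ℝ) + 1) ≠ 0 := by positivity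
    have e3 : (fun ω => max (X ω) 0 * Real.exp ((r - t) * X ω) *
        (a * Real.exp (-(t * max (X ω) 0)) ^ n)) = fun ω => a *
        (max (X ω) 0 * Real.exp ((r - ((n:ℝ) + 1) * t) * X ω)) := by
      funext ω
      rcases le_total (X ω) 0 with h | h
      · rw [max_eq_right h]; ring
      · rw [max_eq_left h, ← Real.exp_nat_mul]
        have : Real.exp ((r - ((n:ℝ) + 1) * t) * X ω)
            = Real.exp ((r - t) * X ω) * Real.exp (n * -(t * X ω)) := by
          rw [← Real.exp_add]; ring_nf
        rw [this]; ring
    rw [e3, integral_const_mul]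
    field_simp

lemma aux_lower {Ω : Type*} [MeasurableSpace Ω] (μ : Measure Ω) [IsProbabilityMeasure μ]
    (X : Ω → ℝ) (hX : Measurable X)
    (r κ : ℝ) (hr0 : 0 < r) (hκ : 0 < κ) (hr : Integrable (fun ω => Real.exp (r * X ω)) μ)
    (h : Tendsto (fun s => √s * ∫ ω, X ω * Real.exp ((r - s) * X ω) ∂μ) (nhdsWithin 0 (Ioi 0))
      (nhds κ)) (K : ℝ) (hK : 1 < K) :
    ∃ c > 0, ∀ᶠ x in atTop, c ≤ √x * Real.exp (r * K * x) * μ.real {ω | x < X ω} := by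
  have hpoly := aux_poly μ X hX r κ hr (aux_pos_part μ X hX r κ hr0 hr h)
  set g : ℝ → ℝ := fun u => max 0 ((u - Real.exp (-K)) * (Real.exp (-1) - u)) with hg
  have hgc : Continuous g := by fun_prop
  have hg0 : ∀ u, 0 ≤ g u := fun u => le_max_left _ _
  have hab : Real.exp (-K) < Real.exp (-1) := Real.exp_lt_exp.2 (by linarith)
  have hb1 : Real.exp (-1) < 1 := by rw [Real.exp_lt_one_iff]; norm_num
  have ha0 := Real.exp_pos (-K)
  have hg1 : ∀ u, g u ≤ 1 := by
    intro u
    apply max_le zero_le_one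
    nlinarith [sq_nonneg ((u - Real.exp (-K)) - (Real.exp (-1) - u)), sq_nonneg (Real.exp (-1) - Real.exp (-K))]
  have hgs : ∀ u, 0 < g u → Real.exp (-K) < u ∧ u < Real.exp (-1) := by
    intro u hu
    have : 0 < (u - Real.exp (-K)) * (Real.exp (-1) - u) := by
      by_contra hh
      rw [hg] at hu; simp only at hu
      rw [max_eq_left (not_lt.1 hh)] at hu; exact lt_irrefl _ hu
    rcases pos_and_pos_or_neg_and_neg_of_mul_pos this with h | h
    · constructor <;> linarith [h.1, h.2]
    · exfalso; linarith [h.1, h.2]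
  have hIg : 0 < ∫ y in Ioi (0:ℝ), y ^ ((1/2:ℝ) - 1) * Real.exp (-y) * g (Real.exp (-y)) := by
    rw [integral_pos_iff_support_of_nonneg_ae _ (aux_int_gam g hgc)]
    · have hsub : Ioo 1 K ⊆ Function.support
          (fun y : ℝ => y ^ ((1/2:ℝ) - 1) * Real.exp (-y) * g (Real.exp (-y))) := by
        intro y hy
        have hy0 : 0 < y := by linarith [hy.1]
        have : 0 < g (Real.exp (-y)) := by
          apply lt_max_of_lt_right
          apply mul_pos
          · rw [sub_pos]; exact Real.exp_lt_exp.2 (by linarith [hy.2])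
          · rw [sub_pos]; exact Real.exp_lt_exp.2 (by linarith [hy.1])
        rw [Function.mem_support]
        positivity
      refine lt_of_lt_of_le ?_ (measure_mono hsub)
      rw [Measure.restrict_apply measurableSet_Ioo, inter_eq_left.2]
      · simp [hK]
      · intro y hy; exact lt_trans one_pos hy.1
    · filter_upwards [ae_restrict_mem measurableSet_Ioi] with y hy
      have : (0:ℝ) < y := hy
      have := hg0 (Real.exp (-y))
      positivity
  set I : ℝ := ∫ y in Ioi (0:ℝ), y ^ ((1/2:ℝ) - 1) * Real.exp (-y) * g (Real.exp (-y)) with hI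
  set J : ℝ := ∫ y in Ioi (0:ℝ), y ^ ((1/2:ℝ) - 1) * Real.exp (-y) *
    (1 : Polynomial ℝ).eval (Real.exp (-y)) with hJ
  have hJ0 : 0 ≤ J := by
    apply setIntegral_nonneg measurableSet_Ioi
    intro y hy
    have : (0:ℝ) < y := hy
    simp only [Polynomial.eval_one]; positivity
  set η := I / (4 * (J + 1)) with hη
  have hη0 : 0 < η := by positivity
  obtain ⟨p, hp⟩ := exists_polynomial_near_of_continuousOn 0 1 g hgc.continuousOn η hη0
  set Ip : ℝ := ∫ y in Ioi (0:ℝ), y ^ ((1/2:ℝ) - 1) * Real.exp (-y) * p.eval (Real.exp (-y)) with hIp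
  have hIp' : I - η * J ≤ Ip := by
    rw [hI, hJ, hIp, ← integral_const_mul, ← integral_sub (aux_int_gam g hgc)
      ((aux_int_gam _ (Polynomial.continuous _)).const_mul _)]
    refine setIntegral_mono_on ((aux_int_gam g hgc).sub
      ((aux_int_gam _ (Polynomial.continuous _)).const_mul _)) (aux_int_gam _ p.continuous)
      measurableSet_Ioi ?_
    intro y hy
    have hy0 : (0:ℝ) < y := hy
    have h1 := (abs_lt.1 (hp (Real.exp (-y)) ⟨by positivity, Real.exp_le_one_iff.2 (by linarith)⟩)).1
    have h2 : 0 ≤ y ^ ((1/2:ℝ) - 1) * Real.exp (-y) := by positivity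
    simp only [Polynomial.eval_one]
    nlinarith
  have hηJ : η * J ≤ I / 4 := by
    rw [hη, div_mul_eq_mul_div, div_le_div_iff₀ (by positivity) (by norm_num)]
    nlinarith
  have hπ : 0 < κ / √π := by positivity
  have hlim := (hpoly p).sub ((hpoly 1).const_mul η)
  have hlp : κ / √π * (I / 4) < κ / √π * Ip - η * (κ / √π * J) := by
    have : κ / √π * Ip - η * (κ / √π * J) = κ / √π * (Ip - η * J) := by ring
    rw [this]
    apply mul_lt_mul_of_pos_left _ hπ
    linarith
  have hev := hlim.eventually (lt_mem_nhds hlp)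
  have hev2 := tendsto_inv_atTop_nhdsGT_zero.eventually hev
  refine ⟨κ / √π * (I / 4) / K, by positivity, ?_⟩
  filter_upwards [hev2, eventually_gt_atTop 0] with x hx hx0
  have ht : 0 < x⁻¹ := by positivity
  set t := x⁻¹ with htx
  have htx1 : t * x = 1 := by rw [htx]; field_simp
  have hgi : √t * ∫ ω, max (X ω) 0 * Real.exp ((r - t) * X ω) *
      p.eval (Real.exp (-(t * max (X ω) 0))) ∂μ - η * (√t * ∫ ω, max (X ω) 0 *
      Real.exp ((r - t) * X ω) * (1 : Polynomial ℝ).eval (Real.exp (-(t * max (X ω) 0))) ∂μ) ≤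
      √t * ∫ ω, max (X ω) 0 * Real.exp ((r - t) * X ω) * g (Real.exp (-(t * max (X ω) 0))) ∂μ := by
    rw [← mul_assoc, mul_comm η, mul_assoc, ← mul_sub]
    apply mul_le_mul_of_nonneg_left _ (Real.sqrt_nonneg _)
    have hi1 := aux_int_wtf μ X hX r t ht hr _ p.continuous
    have hi2 := (aux_int_wtf μ X hX r t ht hr _ (1 : Polynomial ℝ).continuous).const_mul η
    rw [← integral_const_mul, ← integral_sub hi1 hi2]
    refine integral_mono (hi1.sub hi2) (aux_int_wtf μ X hX r t ht hr g hgc) ?_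
    intro ω
    have h0 : (0:ℝ) ≤ max (X ω) 0 := le_max_right _ _
    have h1 := (abs_lt.1 (hp (Real.exp (-(t * max (X ω) 0))) ⟨by positivity,
      Real.exp_le_one_iff.2 (by nlinarith [mul_nonneg ht.le h0])⟩)).2
    have h2 : 0 ≤ max (X ω) 0 * Real.exp ((r - t) * X ω) := by positivity
    simp only [Polynomial.eval_one]
    nlinarith
  have hmeas : MeasurableSet {ω | x < X ω} := measurableSet_lt measurable_const hX
  have hup : ∫ ω, max (X ω) 0 * Real.exp ((r - t) * X ω) * g (Real.exp (-(t * max (X ω) 0))) ∂μ ≤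
      K * x * Real.exp (r * K * x) * μ.real {ω | x < X ω} := by
    calc _ ≤ ∫ ω, {ω | x < X ω}.indicator (fun _ => K * x * Real.exp (r * K * x)) ω ∂μ := by
          refine integral_mono (aux_int_wtf μ X hX r t ht hr g hgc)
            ((integrable_const _).indicator hmeas) ?_
          intro ω
          simp only
          have h0 : (0:ℝ) ≤ max (X ω) 0 := le_max_right _ _
          rcases (hg0 (Real.exp (-(t * max (X ω) 0)))).eq_or_lt with he | hl
          · rw [← he, mul_zero]
            apply indicator_nonneg
            intro _ _; positivity
          · obtain ⟨h1, h2⟩ := hgs _ hl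
            rw [Real.exp_lt_exp] at h1 h2
            have h3 : x < max (X ω) 0 := by
              by_contra hh
              nlinarith [mul_le_mul_of_nonneg_left (not_lt.1 hh) ht.le]
            have h4 : max (X ω) 0 < K * x := by
              by_contra hh
              have := mul_le_mul_of_nonneg_left (not_lt.1 hh) ht.le
              have e : t * (K * x) = K := by rw [mul_left_comm, htx1, mul_one]
              linarith
            have h5 : x < X ω := by
              rcases lt_max_iff.1 h3 with h | h
              · exact h
              · linarith
            rw [indicator_of_mem (show ω ∈ {ω | x < X ω} from h5)]
            rw [max_eq_left (by linarith)] at h4 ⊢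
            have h6 : Real.exp ((r - t) * X ω) ≤ Real.exp (r * K * x) := by
              apply Real.exp_le_exp.2
              have : 0 < t * X ω := mul_pos ht (by linarith)
              nlinarith
            have h7 := hg1 (Real.exp (-(t * X ω)))
            have h8 := hg0 (Real.exp (-(t * X ω)))
            calc _ ≤ K * x * Real.exp (r * K * x) * 1 := by gcongr
              _ = _ := mul_one _
      _ = _ := by
          rw [integral_indicator hmeas, setIntegral_const, smul_eq_mul, mul_comm]
  have hsx : √t * x = √x := by
    rw [htx, Real.sqrt_inv, inv_mul_eq_div, Real.div_sqrt]
  rw [div_le_iff₀ (by linarith)]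
  calc κ / √π * (I / 4) ≤ _ := (hx.trans_le hgi).le
    _ ≤ √t * (K * x * Real.exp (r * K * x) * μ.real {ω | x < X ω}) :=
        mul_le_mul_of_nonneg_left hup (Real.sqrt_nonneg _)
    _ = _ := by rw [← hsx]; ring

lemma aux_tail {Ω : Type*} [MeasurableSpace Ω] (μ : Measure Ω) [IsProbabilityMeasure μ]
    (X : Ω → ℝ) (hX : Measurable X)
    (r κ : ℝ) (hr0 : 0 < r) (hκ : 0 < κ) (hr : Integrable (fun ω => Real.exp (r * X ω)) μ)
    (h : Tendsto (fun s => √s * ∫ ω, X ω * Real.exp ((r - s) * X ω) ∂μ) (nhdsWithin 0 (Ioi 0))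
      (nhds κ)) (F : ℝ → ℝ) (hF1 : ∀ x, μ.real {ω | x < X ω} ≤ F x)
      (hF2 : ∀ x, F x ≤ μ.real {ω | x ≤ X ω}) :
    Tendsto (fun x => Real.log (F x) / (-(r * x))) atTop (nhds 1) := by
  have hlog : Tendsto (fun x : ℝ => Real.log x / x) atTop (nhds 0) := by
    have := Real.isLittleO_log_id_atTop.tendsto_div_nhds_zero
    simpa using this
  have hcx : ∀ c : ℝ, Tendsto (fun x : ℝ => c / x) atTop (nhds 0) := fun c =>
    tendsto_const_nhds.div_atTop tendsto_id
  have hFpos : ∀ᶠ x in atTop, 0 < F x := by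
    obtain ⟨c, hc, hev⟩ := aux_lower μ X hX r κ hr0 hκ hr h 2 (by norm_num)
    filter_upwards [hev] with x hx
    refine lt_of_lt_of_le ?_ (hF1 x)
    by_contra hh
    have h0 : μ.real {ω | x < X ω} = 0 := le_antisymm (not_lt.1 hh) measureReal_nonneg
    rw [h0, mul_zero] at hx
    linarith
  rw [tendsto_order]
  constructor
  · -- upper tail bound
    intro a ha
    set M := ProbabilityTheory.mgf X μ r with hM
    have hM0 : 0 < M := ProbabilityTheory.mgf_pos hr
    have hl : Tendsto (fun x : ℝ => 1 - (Real.log M / r) / x) atTop (nhds 1) := by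
      simpa using (hcx (Real.log M / r)).const_sub 1
    filter_upwards [hFpos, eventually_gt_atTop 0, hl.eventually (lt_mem_nhds ha)] with x hFx hx0 hx
    refine hx.trans_le ?_
    have h1 := (hF2 x).trans (ProbabilityTheory.measure_ge_le_exp_mul_mgf x hr0.le hr)
    have h2 := Real.log_le_log hFx h1
    rw [Real.log_mul (by positivity) hM0.ne', Real.log_exp] at h2
    rw [div_neg, le_neg, div_le_iff₀ (by positivity)]
    have : -(1 - Real.log M / r / x) * (r * x) = -r * x + Real.log M := by
      field_simp; ring
    rw [this]; exact h2
  · intro b hb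
    set K := (1 + b) / 2 with hKd
    obtain ⟨c, hc, hev⟩ := aux_lower μ X hX r κ hr0 hκ hr h K (by linarith)
    have hl : Tendsto (fun x : ℝ => K + (1 / (2 * r)) * (Real.log x / x) - (Real.log c / r) / x)
        atTop (nhds K) := by
      simpa using ((hlog.const_mul (1 / (2 * r))).const_add K).sub (hcx (Real.log c / r))
    filter_upwards [hFpos, eventually_gt_atTop 0, hev,
      hl.eventually (gt_mem_nhds (show K < b by linarith))] with x hFx hx0 hx hxb
    refine lt_of_le_of_lt ?_ hxb
    have h1 : c ≤ √x * Real.exp (r * K * x) * F x := hx.trans (by gcongr; exact hF1 x)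
    have h2 := Real.log_le_log hc h1
    have hs : √x ≠ 0 := by positivity
    rw [Real.log_mul (by positivity) hFx.ne', Real.log_mul hs (by positivity), Real.log_exp,
      Real.log_sqrt hx0.le] at h2
    rw [div_neg, neg_le, le_div_iff₀ (by positivity)]
    have : -(K + 1 / (2 * r) * (Real.log x / x) - Real.log c / r / x) * (r * x)
        = Real.log c - Real.log x / 2 - r * K * x := by
      field_simp; ring
    rw [this]; linarith

lemma aux_nig {Ω : Type*} [MeasurableSpace Ω] (μ : Measure Ω) [IsProbabilityMeasure μ]
    (X : Ω → ℝ) (hX : Measurable X)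
    (α β δ μ₀ : ℝ) (hα : 0 < α) (hβ : |β| < α) (hδ : 0 < δ)
    (hmgf : ∀ s ∈ Set.Icc (-(α + β)) (α - β),
      Integrable (fun ω => Real.exp (s * X ω)) μ ∧
      ∫ ω, Real.exp (s * X ω) ∂μ =
        Real.exp (δ * (Real.sqrt (α ^ 2 - β ^ 2) - Real.sqrt (α ^ 2 - (β + s) ^ 2))
          + μ₀ * s))
    (F : ℝ → ℝ) (hF1 : ∀ x, μ.real {ω | x < X ω} ≤ F x)
      (hF2 : ∀ x, F x ≤ μ.real {ω | x ≤ X ω}) :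
    Tendsto (fun x => Real.log (F x) / (-((α - β) * x))) atTop (nhds 1) := by
  obtain ⟨hb1, hb2⟩ := abs_lt.1 hβ
  set m : ℝ → ℝ := fun s => Real.exp (δ * (Real.sqrt (α ^ 2 - β ^ 2) -
    Real.sqrt (α ^ 2 - (β + s) ^ 2)) + μ₀ * s) with hm
  have hmc : Continuous m := by fun_prop
  set r := α - β with hrd
  have hder : ∀ s ∈ Ioo 0 α, ∫ ω, X ω * Real.exp ((r - s) * X ω) ∂μ =
      m (r - s) * (δ * ((α - s) / √(s * (2 * α - s))) + μ₀) := by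
    intro s hs
    have hv : r - s ∈ Ioo (-(α + β)) (α - β) := ⟨by linarith [hs.2], by linarith [hs.1]⟩
    have hsub : Ioo (-(α + β)) (α - β) ⊆ ProbabilityTheory.integrableExpSet X μ := fun v hv =>
      (hmgf v (Ioo_subset_Icc_self hv)).1
    have h1 := ProbabilityTheory.hasDerivAt_mgf (interior_maximal hsub isOpen_Ioo hv)
    have h2 : ProbabilityTheory.mgf X μ =ᶠ[nhds (r - s)] m := by
      filter_upwards [isOpen_Ioo.mem_nhds hv] with v hv
      exact (hmgf v (Ioo_subset_Icc_self hv)).2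
    have h3 := h1.congr_of_eventuallyEq h2.symm
    have hq : α ^ 2 - (β + (r - s)) ^ 2 = s * (2 * α - s) := by rw [hrd]; ring
    have hq0 : 0 < s * (2 * α - s) := mul_pos hs.1 (by linarith [hs.2])
    have h4 : HasDerivAt (fun v => α ^ 2 - (β + v) ^ 2) (-(2 * (β + (r - s)))) (r - s) := by
      have := (((hasDerivAt_id (r - s)).const_add β).pow 2).const_sub (α ^ 2)
      refine this.congr_deriv ?_
      simp
    have h5 := h4.sqrt (by rw [hq]; exact hq0.ne')
    have h6 := (((h5.const_sub (√(α ^ 2 - β ^ 2))).const_mul δ).add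
      ((hasDerivAt_id (r - s)).const_mul μ₀)).exp
    have h7 := h3.unique h6
    refine h7.trans ?_
    have h8 : β + (r - s) = α - s := by rw [hrd]; ring
    change m (r - s) * _ = _
    rw [hq, h8]
    congr 1
    have : √(s * (2 * α - s)) ≠ 0 := by positivity
    field_simp
  have hr := (hmgf r ⟨by linarith, le_rfl⟩).1
  refine aux_tail μ X hX r (m r * (δ * (α / √(2 * α)))) (by linarith) (by positivity) hr ?_ F hF1 hF2
  have hl : Tendsto (fun s : ℝ => m (r - s) * (δ * ((α - s) / √(2 * α - s)) + μ₀ * √s))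
      (nhdsWithin 0 (Ioi 0)) (nhds (m r * (δ * (α / √(2 * α))))) := by
    have hc : ContinuousAt (fun s : ℝ => m (r - s) * (δ * ((α - s) / √(2 * α - s)) + μ₀ * √s)) 0 := by
      have : √(2 * α - 0) ≠ 0 := by rw [sub_zero]; positivity
      fun_prop (disch := assumption)
    have := hc.tendsto.mono_left (nhdsWithin_le_nhds (s := Ioi 0))
    simpa using this
  refine hl.congr' ?_
  filter_upwards [Ioo_mem_nhdsGT hα] with s hs
  rw [hder s hs, Real.sqrt_mul hs.1.le]
  have h1 : √s ≠ 0 := by have := hs.1; positivity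
  have h2 : √(2 * α - s) ≠ 0 := by
    have : 0 < 2 * α - s := by linarith [hs.2]
    positivity
  field_simp

/-- **Normal Inverse Gaussian.** If `X` has mgf
`E[e^{sX}] = exp{δ(√(α²-β²) - √(α²-(β+s)²)) + μ₀ s}` on `[-(α+β), α-β]`, infinite
otherwise, then `log P(X > x) ~ -(α-β) x` and `log P(X ≤ -x) ~ -(α+β) x`
as `x → ∞`. -/
theorem normalInverseGaussian_tails
    {Ω : Type*} [MeasurableSpace Ω] (μ : Measure Ω) [IsProbabilityMeasure μ]
    (X : Ω → ℝ) (hX : Measurable X)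
    (α β δ μ₀ : ℝ) (hα : 0 < α) (hβ : |β| < α) (hδ : 0 < δ)
    (hmgf : ∀ s ∈ Set.Icc (-(α + β)) (α - β),
      Integrable (fun ω => Real.exp (s * X ω)) μ ∧
      ∫ ω, Real.exp (s * X ω) ∂μ =
        Real.exp (δ * (Real.sqrt (α ^ 2 - β ^ 2) - Real.sqrt (α ^ 2 - (β + s) ^ 2))
          + μ₀ * s))
    (hinf : ∀ s : ℝ, s ∉ Set.Icc (-(α + β)) (α - β) →
      ¬ Integrable (fun ω => Real.exp (s * X ω)) μ) :
    Tendsto (fun x => Real.log ((μ {ω | x < X ω}).toReal) / (-((α - β) * x)))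
      atTop (nhds 1) ∧
    Tendsto (fun x => Real.log ((μ {ω | X ω ≤ -x}).toReal) / (-((α + β) * x)))
      atTop (nhds 1) := by
  obtain ⟨hb1, hb2⟩ := abs_lt.1 hβ
  constructor
  · exact aux_nig μ X hX α β δ μ₀ hα hβ hδ hmgf (fun x => (μ {ω | x < X ω}).toReal)
      (fun x => le_rfl) (fun x => measureReal_mono (fun ω (hω : x < X ω) => show x ≤ X ω from le_of_lt hω))
  · have hm' : ∀ s ∈ Set.Icc (-(α + -β)) (α - -β),
        Integrable (fun ω => Real.exp (s * (-X ω))) μ ∧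
        ∫ ω, Real.exp (s * (-X ω)) ∂μ =
          Real.exp (δ * (Real.sqrt (α ^ 2 - (-β) ^ 2) - Real.sqrt (α ^ 2 - (-β + s) ^ 2))
            + (-μ₀) * s) := by
      intro s hs
      have h := hmgf (-s) ⟨by linarith [hs.2], by linarith [hs.1]⟩
      have e : ∀ ω, s * (-X ω) = -s * X ω := fun ω => by ring
      have e2 : (-β + s) ^ 2 = (β + -s) ^ 2 := by ring
      simp only [e, e2, neg_sq]
      refine ⟨h.1, h.2.trans ?_⟩
      congr 1; ring
    have := aux_nig μ (fun ω => -X ω) hX.neg α (-β) δ (-μ₀) hα (by rwa [abs_neg]) hδ hm'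
      (fun x => (μ {ω | X ω ≤ -x}).toReal)
      (fun x => measureReal_mono (fun ω (hω : x < -X ω) => show X ω ≤ -x by linarith))
      (fun x => measureReal_mono (fun ω (hω : X ω ≤ -x) => show x ≤ -X ω by linarith))
    simpa only [sub_neg_eq_add] using this
end
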